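/- arXiv:1006.4690 — 2 statements merged into one kernel-verified Lean document; each statement's English description precedes it below -/
import Mathlib

section
/- (Approximative Ore condition.) For every ε > 0 and every pair (s, a) ∈ S × A there exists a pair (t, b) ∈ S × A such that, for all 1 ≤ i ≤ m, |at − sb|ᵢ ≤ ε·|a|ᵢ·|t|ᵢ and |s|ᵢ·|b|ᵢ ≤ |a|ᵢ·|t|ᵢ; if ε < 1 then moreover |s|ᵢ·|b|ᵢ = |a|ᵢ·|t|ᵢ for all i; and if additionally a ∈ S and ε < 1 then b ∈ S₁ ∩ … ∩ Sₘ. Symmetrically, there also exists a pair (t′, b′) ∈ S × A such that, for all 1 ≤ i ≤ m, |t′a − b′s|ᵢ ≤ ε·|a|ᵢ·|t′|ᵢ and |s|ᵢ·|b′|ᵢ ≤ |a|ᵢ·|t′|ᵢ. -/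
/-- A multiplicative nonarchimedean norm on a (possibly noncommutative) unital ring. -/
def IsMultNorm {A : Type*} [Ring A] (f : A → ℝ) : Prop :=
  (∀ a, 0 ≤ f a) ∧ (∀ a, f a = 0 ↔ a = 0) ∧
  (∀ a b, f (a + b) ≤ max (f a) (f b)) ∧ f 1 = 1 ∧
  (∀ a b, f (a * b) = f a * f b)

/-- A quasi-abelian multiplicative norm: `|ab - ba| ≤ γ·|ab|` for some `0 < γ < 1`. -/
def IsQuasiAbelian {A : Type*} [Ring A] (f : A → ℝ) : Prop :=
  IsMultNorm f ∧ ∃ γ : ℝ, 0 < γ ∧ γ < 1 ∧ ∀ a b, f (a * b - b * a) ≤ γ * f (a * b)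

/-- The saturation of `S` with respect to the norm `f`. -/
def Sat {A : Type*} [Ring A] (f : A → ℝ) (S : Set A) : Set A :=
  {a | ∃ s ∈ S, ∃ t ∈ S, f (a * t - s) < f s}

namespace IsMultNorm

variable {A : Type*} [Ring A] {f : A → ℝ}

theorem map_neg (hf : IsMultNorm f) (a : A) : f (-a) = f a := by
  obtain ⟨h0, -, -, h1, hmul⟩ := hf
  have hsq : f (-1) * f (-1) = 1 := by rw [← hmul, neg_one_mul, neg_neg, h1]
  have hone : f (-1) = 1 := by nlinarith [h0 (-1)]
  rw [← neg_one_mul, hmul, hone, one_mul]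

theorem map_sub_le_max (hf : IsMultNorm f) (a b : A) : f (a - b) ≤ max (f a) (f b) := by
  rw [sub_eq_add_neg, ← hf.map_neg b]
  exact hf.2.2.1 a (-b)

theorem map_sub_comm (hf : IsMultNorm f) (a b : A) : f (a - b) = f (b - a) := by
  rw [← hf.map_neg, neg_sub]

theorem map_pow (hf : IsMultNorm f) (a : A) (n : ℕ) : f (a ^ n) = f a ^ n := by
  induction n with
  | zero => simpa using hf.2.2.2.1
  | succ n ih => rw [pow_succ, pow_succ, hf.2.2.2.2, ih]

theorem map_pos (hf : IsMultNorm f) {a : A} (ha : a ≠ 0) : 0 < f a :=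
  (hf.1 a).lt_of_ne fun h => ha ((hf.2.1 a).1 h.symm)

/-- An element that is closer to `a` than the size of `a` has the same size as `a`. -/
theorem eq_of_map_sub_lt (hf : IsMultNorm f) {a b : A} (h : f (a - b) < f a) : f b = f a := by
  refine le_antisymm ?_ ?_
  · have := hf.map_sub_le_max a (a - b)
    rwa [sub_sub_cancel, max_eq_left h.le] at this
  · have := hf.2.2.1 (a - b) b
    rw [sub_add_cancel] at this
    exact (le_max_iff.1 this).resolve_left h.not_ge

/-- If `a` and `b` differ by at most the size of `a`, then `b` is at most as large as `a`. -/
theorem le_of_map_sub_le (hf : IsMultNorm f) {a b : A} (h : f (a - b) ≤ f a) : f b ≤ f a := by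
  have := hf.map_sub_le_max a (a - b)
  rwa [sub_sub_cancel, max_eq_left h] at this

end IsMultNorm

section Commutators

variable {A ι : Type*} [Ring A] {f : ι → A → ℝ} {γ : ι → ℝ}

theorem exists_mul_pow_sub_mul_le (hf : ∀ i, IsMultNorm (f i)) (hγ0 : ∀ i, 0 ≤ γ i)
    (hγ : ∀ i a b, f i (a * b - b * a) ≤ γ i * f i (a * b)) (s a : A) (n : ℕ) :
    ∃ b, ∀ i, f i (a * s ^ n - s * b) ≤ γ i ^ n * (f i a * f i (s ^ n)) := by
  suffices h : ∃ b c, a * s ^ n - s * b = c ∧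
      ∀ i, f i c ≤ γ i ^ n * (f i a * f i (s ^ n)) by
    obtain ⟨b, c, rfl, hc⟩ := h
    exact ⟨b, hc⟩
  induction n with
  | zero => exact ⟨0, a, by simp, fun i => by simp [(hf i).2.2.2.1]⟩
  | succ n ih =>
    obtain ⟨b, c, hbc, hc⟩ := ih
    refine ⟨b * s + c, c * s - s * c, ?_, fun i => ?_⟩
    · rw [← hbc]
      noncomm_ring
    · calc f i (c * s - s * c) ≤ γ i * (f i c * f i s) := by
            rw [← (hf i).2.2.2.2]
            exact hγ i c s
        _ ≤ γ i * (γ i ^ n * (f i a * f i (s ^ n)) * f i s) :=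
            mul_le_mul_of_nonneg_left
              (mul_le_mul_of_nonneg_right (hc i) ((hf i).1 s)) (hγ0 i)
        _ = γ i ^ (n + 1) * (f i a * f i (s ^ (n + 1))) := by
            rw [(hf i).map_pow, (hf i).map_pow]
            ring

theorem exists_pow_mul_sub_mul_le (hf : ∀ i, IsMultNorm (f i)) (hγ0 : ∀ i, 0 ≤ γ i)
    (hγ : ∀ i a b, f i (a * b - b * a) ≤ γ i * f i (a * b)) (s a : A) (n : ℕ) :
    ∃ b, ∀ i, f i (s ^ n * a - b * s) ≤ γ i ^ n * (f i a * f i (s ^ n)) := by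
  obtain ⟨b, hb⟩ := exists_mul_pow_sub_mul_le (A := Aᵐᵒᵖ)
    (f := fun i x => f i x.unop) (γ := γ)
    (fun i => ⟨fun x => (hf i).1 _, fun x => by simp [(hf i).2.1],
      fun x y => (hf i).2.2.1 _ _, (hf i).2.2.2.1,
      fun x y => by simp [(hf i).2.2.2.2, mul_comm]⟩) hγ0
    (fun i x y => by
      have h := hγ i x.unop y.unop
      rw [(hf i).map_sub_comm, (hf i).2.2.2.2, mul_comm (f i _), ← (hf i).2.2.2.2] at h
      exact h)
    (MulOpposite.op s) (MulOpposite.op a) n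
  exact ⟨b.unop, fun i => by simpa using hb i⟩

end Commutators

theorem statement2 {A : Type*} [Ring A] {m : ℕ} (hm : 0 < m)
    (f : Fin m → A → ℝ) (hf : ∀ i, IsQuasiAbelian (f i))
    (S : Set A) (h1S : (1 : A) ∈ S) (h0S : (0 : A) ∉ S)
    (hS : ∀ a ∈ S, ∀ b ∈ S, a * b ∈ S)
    (ε : ℝ) (hε : 0 < ε) (s : A) (hs : s ∈ S) (a : A) :
    (∃ t ∈ S, ∃ b : A,
      (∀ i, f i (a * t - s * b) ≤ ε * (f i a * f i t) ∧
        f i s * f i b ≤ f i a * f i t) ∧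
      (ε < 1 → ∀ i, f i s * f i b = f i a * f i t) ∧
      (a ∈ S → ε < 1 → ∀ i, b ∈ Sat (f i) S)) ∧
    (∃ t' ∈ S, ∃ b' : A,
      ∀ i, f i (t' * a - b' * s) ≤ ε * (f i a * f i t') ∧
        f i s * f i b' ≤ f i a * f i t') := by
  choose hN γ hγ0 hγ1 hγ using hf
  obtain ⟨n, hn⟩ : ∃ n : ℕ, ∀ i, γ i ^ n < min ε 1 :=
    (Filter.eventually_all.2 fun i =>
      (tendsto_pow_atTop_nhds_zero_of_lt_one (hγ0 i).le (hγ1 i)).eventually_lt_const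
        (lt_min hε one_pos)).exists
  have hmul i : ∀ x y, f i (x * y) = f i x * f i y := (hN i).2.2.2.2
  have ht : s ^ n ∈ S := by
    clear hn
    induction n with
    | zero => simpa using h1S
    | succ n ih => exact pow_succ s n ▸ hS _ ih _ hs
  have hnonneg i : 0 ≤ f i a * f i (s ^ n) := mul_nonneg ((hN i).1 _) ((hN i).1 _)
  have hleε i : γ i ^ n * (f i a * f i (s ^ n)) ≤ ε * (f i a * f i (s ^ n)) :=
    mul_le_mul_of_nonneg_right ((hn i).le.trans (min_le_left _ _)) (hnonneg i)
  have hle1 i : γ i ^ n * (f i a * f i (s ^ n)) ≤ f i a * f i (s ^ n) :=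
    mul_le_of_le_one_left (hnonneg i) ((hn i).le.trans (min_le_right _ _))
  constructor
  · obtain ⟨b, hb⟩ := exists_mul_pow_sub_mul_le hN (fun i => (hγ0 i).le) hγ s a n
    have hle i : f i s * f i b ≤ f i a * f i (s ^ n) := by
      rw [← hmul, ← hmul]
      exact (hN i).le_of_map_sub_le (hmul i a _ ▸ (hb i).trans (hle1 i))
    have hlt (ha : a ≠ 0) i : f i (a * s ^ n - s * b) < f i (a * s ^ n) := by
      have hpos : 0 < f i a * f i (s ^ n) :=
        mul_pos ((hN i).map_pos ha) ((hN i).map_pos fun h => h0S (h ▸ ht))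
      rw [hmul i a]
      exact (hb i).trans_lt
        (mul_lt_of_lt_one_left hpos ((hn i).trans_le (min_le_right _ _)))
    refine ⟨s ^ n, ht, b, fun i => ⟨(hb i).trans (hleε i), hle i⟩, fun _ i => ?_,
      fun haS _ i => ?_⟩
    · by_cases ha : a = 0
      · refine (hle i).antisymm ?_
        rw [ha, ((hN i).2.1 0).2 rfl, zero_mul]
        exact mul_nonneg ((hN i).1 _) ((hN i).1 _)
      · rw [← hmul, ← hmul]
        exact (hN i).eq_of_map_sub_lt (hlt ha i)
    · have hlt := hlt (fun h => h0S (h ▸ haS)) i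
      have hpos : 0 < f i (a * s ^ n) := ((hN i).1 _).trans_lt hlt
      have hcomm : f i (s * b - b * s) < f i (a * s ^ n) := by
        have h := hγ i s b
        rw [(hN i).eq_of_map_sub_lt hlt] at h
        exact h.trans_lt (mul_lt_of_lt_one_left hpos (hγ1 i))
      refine ⟨a * s ^ n, hS _ haS _ ht, s, hs, ?_⟩
      rw [(hN i).map_sub_comm, ← sub_add_sub_cancel _ (s * b)]
      exact ((hN i).2.2.1 _ _).trans_lt (max_lt hlt hcomm)
  · obtain ⟨b, hb⟩ := exists_pow_mul_sub_mul_le hN (fun i => (hγ0 i).le) hγ s a n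
    refine ⟨s ^ n, ht, b, fun i => ⟨(hb i).trans (hleε i), ?_⟩⟩
    rw [mul_comm, mul_comm (f i a), ← hmul, ← hmul]
    refine (hN i).le_of_map_sub_le ((hb i).trans ?_)
    rw [hmul, mul_comm (f i (s ^ n))]
    exact hle1 i
end

section
/- (Density of right multiples of a fixed denominator.) For any fixed t ∈ S, any pair (u, c) ∈ S × A and any ε > 0 there exist σ ∈ S and α ∈ A such that d((u, c), (σu, αt)) ≤ ε · max over 1 ≤ i ≤ m of |u|ᵢ⁻¹·|c|ᵢ. In particular, for every ε′ > 0 there exist s ∈ S and a ∈ A with d((u, c), (s, a·t)) < ε′. -/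
/-- `Δ(x,y) = |s|⁻¹·|t|⁻¹·|at − sb|` for `x = (s,a)`, `y = (t,b)`. -/
noncomputable def Delta {A : Type*} [Ring A] (f : A → ℝ) (x y : A × A) : ℝ :=
  (f x.1)⁻¹ * (f y.1)⁻¹ * f (x.2 * y.1 - x.1 * y.2)

/-- `dᵢ(x,y)` : the infimum over `ξ ∈ Sᵢ × A` of `max(Δᵢ(x,ξ), Δᵢ(y,ξ))`. -/
noncomputable def dI {A : Type*} [Ring A] (f : A → ℝ) (S : Set A) (x y : A × A) : ℝ :=
  sInf {r : ℝ | ∃ ξ : A × A, ξ.1 ∈ Sat f S ∧ r = max (Delta f x ξ) (Delta f y ξ)}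

/-- `d(x,y) = maxᵢ dᵢ(x,y)`. -/
noncomputable def dGlob {A : Type*} [Ring A] {m : ℕ} (f : Fin m → A → ℝ)
    (S : Set A) (x y : A × A) : ℝ :=
  ⨆ i : Fin m, dI (f i) S x y

theorem exists_left_approx {A : Type*} [Ring A] (t c : A) (n : ℕ) :
    ∃ α : A, ∀ (f : A → ℝ) (γ : ℝ), IsMultNorm f → 0 < γ →
      (∀ a b, f (a * b - b * a) ≤ γ * f (a * b)) →
      f (t ^ n * c - α * t) ≤ γ ^ n * (f (t ^ n) * f c) := by
  induction n with
  | zero =>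
    refine ⟨0, fun f γ hf _ _ => ?_⟩
    simp [hf.2.2.2.1]
  | succ n ih =>
    obtain ⟨α, hα⟩ := ih
    refine ⟨t * α + t ^ n * c - α * t, fun f γ hf hγ h => ?_⟩
    have e : t ^ (n + 1) * c - (t * α + t ^ n * c - α * t) * t =
        t * (t ^ n * c - α * t) - (t ^ n * c - α * t) * t := by
      rw [pow_succ']; noncomm_ring
    rw [e, pow_succ' t, hf.2.2.2.2 t]
    calc _ ≤ γ * (f t * f (t ^ n * c - α * t)) := by
          rw [← hf.2.2.2.2]; exact h _ _
      _ ≤ γ * (f t * (γ ^ n * (f (t ^ n) * f c))) := by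
          have := hf.1 t
          have := hα f γ hf hγ h
          gcongr
      _ = _ := by ring

theorem exists_right_approx {A : Type*} [Ring A] (u c : A) (n : ℕ) :
    ∃ b : A, ∀ (f : A → ℝ) (γ : ℝ), IsMultNorm f → 0 < γ →
      (∀ a b, f (a * b - b * a) ≤ γ * f (a * b)) →
      f (c * u ^ n - u * b) ≤ γ ^ n * (f (u ^ n) * f c) := by
  obtain ⟨α, hα⟩ := exists_left_approx (MulOpposite.op u) (MulOpposite.op c) n
  refine ⟨α.unop, fun f γ hf hγ h => ?_⟩
  refine hα (fun x => f x.unop) γ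
    ⟨fun a => hf.1 _, fun a => by simp [hf.2.1], fun a b => hf.2.2.1 _ _, hf.2.2.2.1,
      fun a b => by simp [hf.2.2.2.2, mul_comm]⟩ hγ fun a b => ?_
  exact (h b.unop a.unop).trans_eq' (by simp)

theorem dI_le_max_Delta {A : Type*} [Ring A] {f : A → ℝ} (hf : IsMultNorm f) {S : Set A}
    (x y : A × A) {ξ : A × A} (hξ : ξ.1 ∈ Sat f S) :
    dI f S x y ≤ max (Delta f x ξ) (Delta f y ξ) := by
  refine csInf_le ⟨0, ?_⟩ ⟨ξ, hξ, rfl⟩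
  rintro r ⟨ζ, -, rfl⟩
  have h := hf.1
  exact le_max_of_le_left
    (mul_nonneg (mul_nonneg (inv_nonneg.2 (h _)) (inv_nonneg.2 (h _))) (h _))

theorem IsMultNorm.pos {A : Type*} [Ring A] {f : A → ℝ} (hf : IsMultNorm f) {a : A}
    (ha : a ≠ 0) : 0 < f a :=
  (hf.1 a).lt_of_ne' (mt (hf.2.1 a).1 ha)

theorem subset_Sat {A : Type*} [Ring A] {f : A → ℝ} (hf : IsMultNorm f) {S : Set A}
    (h1S : (1 : A) ∈ S) (h0S : (0 : A) ∉ S) : S ⊆ Sat f S := fun a ha =>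
  ⟨a, ha, 1, h1S, by
    simpa [(hf.2.1 0).2 rfl] using hf.pos (ne_of_mem_of_not_mem ha h0S)⟩

theorem dI_le_of_approx {A : Type*} [Ring A] {f : A → ℝ} (hf : IsMultNorm f) {S : Set A}
    (h1S : (1 : A) ∈ S) (h0S : (0 : A) ∉ S) {u σ s : A} (hu : u ∈ S) (hσ : σ ∈ S) (hs : s ∈ S)
    {c a b : A} {δ : ℝ} (ha : f (σ * c - a) ≤ δ * (f σ * f c))
    (hb : f (c * s - u * b) ≤ δ * (f s * f c)) :
    dI f S (u, c) (σ * u, a) ≤ δ * ((f u)⁻¹ * f c) := by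
  have hpos : ∀ x ∈ S, 0 < f x := fun x hx => hf.pos (ne_of_mem_of_not_mem hx h0S)
  have hu0 := hpos u hu
  have hσ0 := hpos σ hσ
  have hs0 := hpos s hs
  have hneg : ∀ x, f (-x) = f x := fun x => by
    have h1 : f (-1) = 1 := by
      have h2 : f (-1) * f (-1) = 1 := by rw [← hf.2.2.2.2]; simpa using hf.2.2.2.1
      nlinarith [hf.1 (-1)]
    rw [← neg_one_mul, hf.2.2.2.2, h1, one_mul]
  refine (dI_le_max_Delta hf _ _ (ξ := (s, b)) (subset_Sat hf h1S h0S hs)).trans (max_le ?_ ?_)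
  · calc Delta f (u, c) (s, b) ≤ (f u)⁻¹ * (f s)⁻¹ * (δ * (f s * f c)) := by
          unfold Delta; gcongr
      _ = _ := by field_simp
  · have e : a * s - σ * u * b = -(σ * c - a) * s + σ * (c * s - u * b) := by noncomm_ring
    have key : f (a * s - σ * u * b) ≤ δ * (f σ * f s * f c) := by
      rw [e]
      refine (hf.2.2.1 _ _).trans (max_le ?_ ?_)
      · rw [hf.2.2.2.2, hneg]
        calc _ ≤ δ * (f σ * f c) * f s := by gcongr
          _ = _ := by ring
      · rw [hf.2.2.2.2]
        calc _ ≤ f σ * (δ * (f s * f c)) := by gcongr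
          _ = _ := by ring
    calc Delta f (σ * u, a) (s, b) ≤ (f (σ * u))⁻¹ * (f s)⁻¹ * (δ * (f σ * f s * f c)) := by
          unfold Delta
          have := hf.1 (σ * u)
          gcongr
      _ = _ := by rw [hf.2.2.2.2]; field_simp

theorem statement9 {A : Type*} [Ring A] {m : ℕ} (hm : 0 < m)
    (f : Fin m → A → ℝ) (hf : ∀ i, IsQuasiAbelian (f i))
    (S : Set A) (h1S : (1 : A) ∈ S) (h0S : (0 : A) ∉ S)
    (hS : ∀ a ∈ S, ∀ b ∈ S, a * b ∈ S)
    (t : A) (ht : t ∈ S) (u : A) (hu : u ∈ S) (c : A) :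
    (∀ ε : ℝ, 0 < ε → ∃ σ ∈ S, ∃ α : A,
      dGlob f S (u, c) (σ * u, α * t) ≤ ε * ⨆ i : Fin m, (f i u)⁻¹ * f i c) ∧
    (∀ ε' : ℝ, 0 < ε' → ∃ s ∈ S, ∃ a : A,
      dGlob f S (u, c) (s, a * t) < ε') := by
  have hne : Nonempty (Fin m) := ⟨⟨0, hm⟩⟩
  have hpow : ∀ a ∈ S, ∀ n : ℕ, a ^ n ∈ S := fun a ha n => by
    induction n with
    | zero => simpa using h1S
    | succ n ih => rw [pow_succ]; exact hS _ ih _ ha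
  have hle : ∀ i, (f i u)⁻¹ * f i c ≤ ⨆ i : Fin m, (f i u)⁻¹ * f i c :=
    le_ciSup (Set.finite_range fun i => (f i u)⁻¹ * f i c).bddAbove
  have hnn : ∀ i, 0 ≤ (f i u)⁻¹ * f i c := fun i =>
    mul_nonneg (inv_nonneg.2 ((hf i).1.1 _)) ((hf i).1.1 _)
  have main : ∀ ε : ℝ, 0 < ε → ∃ σ ∈ S, ∃ α : A,
      dGlob f S (u, c) (σ * u, α * t) ≤ ε * ⨆ i : Fin m, (f i u)⁻¹ * f i c := by
    intro ε hε
    choose γ hγ0 hγ1 hγ using fun i => (hf i).2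
    obtain ⟨n, hn⟩ : ∃ n : ℕ, ∀ i, γ i ^ n < ε :=
      (Filter.eventually_all.2 fun i =>
        (tendsto_pow_atTop_nhds_zero_of_lt_one (hγ0 i).le (hγ1 i)).eventually_lt_const hε).exists
    obtain ⟨α, hα⟩ := exists_left_approx t c n
    obtain ⟨b, hb⟩ := exists_right_approx u c n
    refine ⟨t ^ n, hpow t ht n, α, ciSup_le fun i => ?_⟩
    calc _ ≤ γ i ^ n * ((f i u)⁻¹ * f i c) :=
          dI_le_of_approx (hf i).1 h1S h0S hu (hpow t ht n) (hpow u hu n)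
            (hα _ _ (hf i).1 (hγ0 i) (hγ i)) (hb _ _ (hf i).1 (hγ0 i) (hγ i))
      _ ≤ ε * ((f i u)⁻¹ * f i c) := mul_le_mul_of_nonneg_right (hn i).le (hnn i)
      _ ≤ _ := mul_le_mul_of_nonneg_left (hle i) hε.le
  refine ⟨main, fun ε' hε' => ?_⟩
  have hM : 0 ≤ ⨆ i : Fin m, (f i u)⁻¹ * f i c := Real.iSup_nonneg hnn
  set M := ⨆ i : Fin m, (f i u)⁻¹ * f i c
  obtain ⟨σ, hσ, α, h⟩ := main (ε' / (M + 1)) (by positivity)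
  refine ⟨σ * u, hS _ hσ _ hu, α, h.trans_lt ?_⟩
  rw [div_mul_eq_mul_div, div_lt_iff₀ (by positivity)]
  nlinarith
end
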